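/- In a quasi-bipartite instance (G has no edge between two Steiner vertices), the integrality gap of the hypergraphic LP (S) is at most α, where α is the unique real solution of α = 1 + exp(−α): the minimum cost opt of a Steiner tree satisfies opt ≤ α · lp*. -/

import Mathlib

/-!
Setting: a finite graph on vertex type `V` is given by its edge set `E : Finset (Sym2 V)`,
with edge costs `c : Sym2 V → ℝ` (nonnegative, satisfying the triangle inequality).
The terminals form a set `R : Finset V`; all other vertices are Steiner vertices.
-/

open Finset

variable {V : Type} [Fintype V] [DecidableEq V]

/-- The total cost of a finite set of edges. -/
def cost (c : Sym2 V → ℝ) (F : Finset (Sym2 V)) : ℝ := ∑ e ∈ F, c e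

/-- The degree of the vertex `v` in the edge set `F`. -/
def degIn (F : Finset (Sym2 V)) (v : V) : ℕ := (F.filter fun e => v ∈ e).card

/-- All pairs of vertices of `K`, as potential edges (the clique on `K`). -/
def cliqueEdges (K : Finset V) : Finset (Sym2 V) := (K ×ˢ K).image fun p => s(p.1, p.2)

/-- `F ⊆ E` is (the edge set of) a Steiner tree for the terminal set `R` in the graph with
edge set `E`: an acyclic edge set in which all terminals are mutually connected and every
vertex touched by `F` is connected to a terminal, i.e. a tree spanning `R` plus any subset
of the Steiner vertices. -/
def IsSteinerTree (E : Finset (Sym2 V)) (R : Finset V) (F : Finset (Sym2 V)) : Prop :=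
  F ⊆ E ∧
  (SimpleGraph.fromEdgeSet (↑F : Set (Sym2 V))).IsAcyclic ∧
  (∀ u ∈ R, ∀ v ∈ R, (SimpleGraph.fromEdgeSet (↑F : Set (Sym2 V))).Reachable u v) ∧
  (∀ v : V, degIn F v ≠ 0 → ∃ r ∈ R, (SimpleGraph.fromEdgeSet (↑F : Set (Sym2 V))).Reachable v r)

/-- `F ⊆ E` is a full component on the terminal set `K ⊆ R` (`|K| ≥ 2`): a tree whose leaf
set is exactly `K` and whose internal vertices are Steiner vertices. -/
def IsFullComponent (E : Finset (Sym2 V)) (R K : Finset V) (F : Finset (Sym2 V)) : Prop :=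
  F ⊆ E ∧ K ⊆ R ∧ 2 ≤ K.card ∧
  (SimpleGraph.fromEdgeSet (↑F : Set (Sym2 V))).IsAcyclic ∧
  (∀ u v : V, degIn F u ≠ 0 → degIn F v ≠ 0 →
    (SimpleGraph.fromEdgeSet (↑F : Set (Sym2 V))).Reachable u v) ∧
  (∀ v : V, degIn F v = 1 ↔ v ∈ K) ∧
  (∀ v : V, 2 ≤ degIn F v → v ∉ R)

/-- `T` is a spanning tree of the induced terminal graph `G[R]`. -/
def IsSpanningTreeOn (E : Finset (Sym2 V)) (R : Finset V) (T : Finset (Sym2 V)) : Prop :=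
  T ⊆ E ∧ (∀ e ∈ T, ∀ v ∈ e, v ∈ R) ∧
  (SimpleGraph.fromEdgeSet (↑T : Set (Sym2 V))).IsAcyclic ∧
  (∀ u ∈ R, ∀ v ∈ R, (SimpleGraph.fromEdgeSet (↑T : Set (Sym2 V))).Reachable u v)

/-- `m` is the minimum of `cost c` over edge sets satisfying `P`. -/
def IsMinCostOf (P : Finset (Sym2 V) → Prop) (c : Sym2 V → ℝ) (m : ℝ) : Prop :=
  (∃ F, P F ∧ cost c F = m) ∧ ∀ F, P F → m ≤ cost c F

/-- Feasibility for the hypergraphic LP (S): `x` is nonnegative, supported on terminal sets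
`K ⊆ R` with `|K| ≥ 2` admitting a full component, and satisfies
`∑_{K : K∩S ≠ ∅} x_K (|K∩S|-1) ≤ |S|-1` for every nonempty `S ⊆ R` as well as
`∑_K x_K (|K|-1) = |R|-1`. -/
def LPFeasible (E : Finset (Sym2 V)) (R : Finset V) (x : Finset V → ℝ) : Prop :=
  (∀ K, 0 ≤ x K) ∧
  (∀ K : Finset V, x K ≠ 0 → K ⊆ R ∧ 2 ≤ K.card ∧ ∃ F, IsFullComponent E R K F) ∧
  (∀ S ⊆ R, S.Nonempty →
    ∑ K ∈ Finset.univ.filter (fun K : Finset V => (K ∩ S).Nonempty),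
      x K * (((K ∩ S).card : ℝ) - 1) ≤ (S.card : ℝ) - 1) ∧
  (∑ K : Finset V, x K * ((K.card : ℝ) - 1) = (R.card : ℝ) - 1)

/-- The objective value `∑_K C_K x_K` of the hypergraphic LP. -/
def lpValue (CK x : Finset V → ℝ) : ℝ := ∑ K : Finset V, CK K * x K

/-- `v` is the optimal value of the hypergraphic LP (S), with `CK K` the cost of a
minimum-cost full component on `K`. -/
def IsLPOpt (E : Finset (Sym2 V)) (R : Finset V) (CK : Finset V → ℝ) (v : ℝ) : Prop :=
  (∃ x, LPFeasible E R x ∧ lpValue CK x = v) ∧ ∀ x, LPFeasible E R x → v ≤ lpValue CK x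

set_option linter.unusedSectionVars false


/-! ### Counting classes of setoids -/

/-- The number of classes of `s` that meet `K`. -/
noncomputable def classCount (s : Setoid V) (K : Finset V) : ℕ :=
  ((Quotient.mk s) '' (K : Set V)).ncard

theorem classCount_mono_set (s : Setoid V) {K K' : Finset V} (h : K ⊆ K') :
    classCount s K ≤ classCount s K' :=
  Set.ncard_le_ncard (Set.image_mono (by exact_mod_cast h)) (Set.toFinite _)

theorem classCount_le_card (s : Setoid V) (K : Finset V) : classCount s K ≤ K.card := by
  have h := Set.ncard_image_le (f := Quotient.mk s) (s := (K : Set V)) (Set.toFinite _)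
  rwa [Set.ncard_coe_finset] at h

theorem classCount_union_le (s : Setoid V) (K K' : Finset V) :
    classCount s (K ∪ K') ≤ classCount s K + K'.card := by
  refine le_trans ?_ (Nat.add_le_add_left (classCount_le_card s K') _)
  unfold classCount
  rw [Finset.coe_union, Set.image_union]
  exact Set.ncard_union_le _ _

theorem classCount_le_one {s : Setoid V} {K : Finset V} (h : ∀ a ∈ K, ∀ b ∈ K, s a b) :
    classCount s K ≤ 1 := by
  refine (Set.ncard_le_one (Set.toFinite _)).2 ?_
  rintro _ ⟨a, ha, rfl⟩ _ ⟨b, hb, rfl⟩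
  exact Quotient.sound (h a ha b hb)

theorem classCount_pos {s : Setoid V} {K : Finset V} (h : K.Nonempty) :
    0 < classCount s K := by
  obtain ⟨a, ha⟩ := h
  exact (Set.ncard_pos (Set.toFinite _)).2 ⟨_, a, ha, rfl⟩

theorem classCount_pair {s : Setoid V} {a b : V} (h : ¬ s a b) :
    classCount s {a, b} = 2 := by
  unfold classCount
  rw [Finset.coe_pair, Set.image_pair, Set.ncard_pair]
  exact fun h' => h (Quotient.exact h')

/-- Merging the classes met by `K'` into one decreases the number of classes accordingly. -/
theorem classCount_add_le {s s' : Setoid V} (hs : s ≤ s') {K K' : Finset V} (hK : K' ⊆ K)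
    (hne : K'.Nonempty) (h : ∀ a ∈ K', ∀ b ∈ K', s' a b) :
    classCount s' K + classCount s K' ≤ classCount s K + 1 := by
  classical
  have hsub : Quotient.mk s '' (K' : Set V) ⊆ Quotient.mk s '' (K : Set V) :=
    Set.image_mono (by exact_mod_cast hK)
  have hdiff := Set.ncard_sdiff_add_ncard_of_subset hsub (Set.toFinite _)
  obtain ⟨a, ha⟩ := hne
  have hcover : Quotient.mk s' '' (K : Set V) ⊆
      insert (Quotient.mk s' a) (Quotient.map' (s₁ := s) (s₂ := s') id (fun _ _ h => hs h) ''
        (Quotient.mk s '' (K : Set V) \ Quotient.mk s '' (K' : Set V))) := by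
    rintro _ ⟨b, hb, rfl⟩
    by_cases hb' : Quotient.mk s b ∈ Quotient.mk s '' (K' : Set V)
    · obtain ⟨d, hd, hdb⟩ := hb'
      exact Or.inl (Quotient.sound (s'.trans (hs (s.symm (Quotient.exact hdb))) (h d hd a ha)))
    · exact Or.inr ⟨_, ⟨⟨b, hb, rfl⟩, hb'⟩, rfl⟩
  have h1 := Set.ncard_le_ncard hcover (Set.toFinite _)
  have h2 := Set.ncard_insert_le (Quotient.mk s' a)
    (Quotient.map' (s₁ := s) (s₂ := s') id (fun _ _ h => hs h) ''
        (Quotient.mk s '' (K : Set V) \ Quotient.mk s '' (K' : Set V)))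
  have h3 := Set.ncard_image_le (f := Quotient.map' (s₁ := s) (s₂ := s') id (fun _ _ h => hs h))
    (s := Quotient.mk s '' (K : Set V) \ Quotient.mk s '' (K' : Set V)) (Set.toFinite _)
  unfold classCount
  omega

theorem classCount_anti {s s' : Setoid V} (hs : s ≤ s') (K : Finset V) :
    classCount s' K ≤ classCount s K := by
  rcases K.eq_empty_or_nonempty with rfl | ⟨a, ha⟩
  · simp [classCount]
  · have h := classCount_add_le hs (K' := {a}) (by simpa using ha) (by simp) (by
      intro b hb d hd
      rw [Finset.mem_singleton] at hb hd
      rw [hb, hd])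
    have := classCount_pos (s := s) (K := {a}) (by simp)
    omega

/-- The partition inequalities are consequences of the constraints of the hypergraphic LP. -/
theorem LPFeasible.partition_le {E : Finset (Sym2 V)} {R : Finset V} {x : Finset V → ℝ}
    (hx : LPFeasible E R x) (s : Setoid V) :
    (classCount s R : ℝ) - 1 ≤ ∑ K : Finset V, x K * ((classCount s K : ℝ) - 1) := by
  classical
  obtain ⟨hx0, hsupp, hsub, htot⟩ := hx
  have hcount : ∀ K : Finset V, classCount s K = (K.image (Quotient.mk s)).card := by
    intro K
    rw [classCount, ← Finset.coe_image, Set.ncard_coe_finset]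
  set part : Quotient s → Finset V := fun q => R.filter fun v => Quotient.mk s v = q with hpart
  have hR : ∑ q ∈ R.image (Quotient.mk s), ((part q).card : ℝ) = R.card := by
    rw [Finset.card_eq_sum_card_image (Quotient.mk s) R]
    push_cast
    rfl
  have h1 : ∑ q ∈ R.image (Quotient.mk s),
      ∑ K ∈ Finset.univ.filter (fun K : Finset V => (K ∩ part q).Nonempty),
        x K * (((K ∩ part q).card : ℝ) - 1) ≤ (R.card : ℝ) - classCount s R := by
    refine (Finset.sum_le_sum (g := fun q => ((part q).card : ℝ) - 1) fun q hq => ?_).trans ?_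
    · refine hsub _ (Finset.filter_subset _ _) ?_
      obtain ⟨v, hv, rfl⟩ := Finset.mem_image.1 hq
      exact ⟨v, by simp [hpart, hv]⟩
    · rw [Finset.sum_sub_distrib, hR, hcount]
      simp
  simp_rw [Finset.sum_filter] at h1
  rw [Finset.sum_comm] at h1
  have h2 : ∀ K : Finset V, (∑ q ∈ R.image (Quotient.mk s), if (K ∩ part q).Nonempty then
      x K * (((K ∩ part q).card : ℝ) - 1) else 0) = x K * ((K.card : ℝ) - classCount s K) := by
    intro K
    by_cases hK : x K = 0
    · simp [hK]
    have hKR := (hsupp K hK).1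
    have hinter : ∀ q, K ∩ part q = K.filter fun v => Quotient.mk s v = q := by
      intro q
      ext v
      simp only [hpart, Finset.mem_inter, Finset.mem_filter]
      exact ⟨fun h => ⟨h.1, h.2.2⟩, fun h => ⟨h.1, hKR h.1, h.2⟩⟩
    rw [← Finset.sum_filter]
    have himg : (R.image (Quotient.mk s)).filter (fun q => (K ∩ part q).Nonempty) =
        K.image (Quotient.mk s) := by
      ext q
      simp only [hinter, Finset.mem_filter, Finset.mem_image, Finset.Nonempty]
      constructor
      · rintro ⟨-, v, hv, h⟩
        exact ⟨v, hv, h⟩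
      · rintro ⟨v, hv, h⟩
        exact ⟨⟨v, hKR hv, h⟩, v, hv, h⟩
    rw [himg, ← Finset.mul_sum, Finset.sum_sub_distrib,
      Finset.card_eq_sum_card_image (Quotient.mk s) K, hcount]
    simp [hinter]
  simp_rw [h2] at h1
  have h3 : ∑ K : Finset V, x K * ((classCount s K : ℝ) - 1) =
      ∑ K : Finset V, x K * ((K.card : ℝ) - 1) -
        ∑ K : Finset V, x K * ((K.card : ℝ) - classCount s K) := by
    rw [← Finset.sum_sub_distrib]
    exact Finset.sum_congr rfl fun K _ => by ring
  rw [h3, htot]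
  linarith

/-! ### Layer-cake integrals -/

theorem intervalIntegrable_indicator_lt (b m : ℝ) :
    IntervalIntegrable (fun t => if t < b then (1 : ℝ) else 0) MeasureTheory.volume 0 m := by
  refine Antitone.intervalIntegrable fun t t' h => ?_
  split_ifs <;> linarith

theorem integral_indicator_lt {b m : ℝ} (hb : 0 ≤ b) (hm : b ≤ m) :
    ∫ t in (0 : ℝ)..m, (if t < b then (1 : ℝ) else 0) = b := by
  have h := intervalIntegrable_indicator_lt b b
  have h' : IntervalIntegrable (fun t => if t < b then (1 : ℝ) else 0)
      MeasureTheory.volume b m := by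
    refine Antitone.intervalIntegrable fun t t' h => ?_
    split_ifs <;> linarith
  rw [← intervalIntegral.integral_add_adjacent_intervals h h']
  have h1 : ∫ t in (0 : ℝ)..b, (if t < b then (1 : ℝ) else 0) = ∫ t in (0 : ℝ)..b, (1 : ℝ) := by
    refine intervalIntegral.integral_congr_ae ?_
    filter_upwards [MeasureTheory.Measure.ae_ne MeasureTheory.volume b] with t ht hmem
    rw [Set.uIoc_of_le hb] at hmem
    rw [if_pos (lt_of_le_of_ne hmem.2 ht)]
  have h2 : ∫ t in b..m, (if t < b then (1 : ℝ) else 0) = ∫ t in b..m, (0 : ℝ) := by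
    refine intervalIntegral.integral_congr fun t ht => ?_
    rw [Set.uIcc_of_le hm] at ht
    exact if_neg (not_lt.2 ht.1)
  rw [h1, h2]
  simp

theorem intervalIntegrable_card_lt {ι : Type*} (I : Finset ι) (b : ι → ℝ) (m : ℝ) :
    IntervalIntegrable (fun t => ((I.filter fun i => t < b i).card : ℝ))
      MeasureTheory.volume 0 m := by
  refine Antitone.intervalIntegrable fun t t' h => ?_
  exact_mod_cast Finset.card_le_card (Finset.monotone_filter_right I fun i _ hi => h.trans_lt hi)

theorem integral_card_lt {ι : Type*} (I : Finset ι) (b : ι → ℝ) {m : ℝ}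
    (h0 : ∀ i ∈ I, 0 ≤ b i) (hm : ∀ i ∈ I, b i ≤ m) :
    ∫ t in (0 : ℝ)..m, ((I.filter fun i => t < b i).card : ℝ) = ∑ i ∈ I, b i := by
  simp_rw [Finset.card_filter]
  push_cast
  rw [intervalIntegral.integral_finsetSum fun i _ => intervalIntegrable_indicator_lt (b i) m]
  exact Finset.sum_congr rfl fun i hi => integral_indicator_lt (h0 i hi) (hm i hi)

/-! ### Greedy spanning structures -/

/-- The setoid identifying the two ends of a labelled pair. -/
def pairSetoid {β : Type*} (e : V × V × β) : Setoid V :=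
  Relation.EqvGen.setoid fun a b => a = e.1 ∧ b = e.2.1

theorem pairSetoid_le_iff {β : Type*} {e : V × V × β} {s : Setoid V} :
    pairSetoid e ≤ s ↔ s e.1 e.2.1 := by
  constructor
  · exact fun h => h (Relation.EqvGen.rel _ _ ⟨rfl, rfl⟩)
  · intro h
    refine Setoid.eqvGen_le ?_
    rintro a b ⟨rfl, rfl⟩
    exact h

/-- Kruskal's algorithm, with the weights of the chosen pairs controlled by class counts. -/
theorem exists_greedy_subset {β : Type*} [DecidableEq β] (R : Finset V) (w : V × V × β → ℝ)
    (A : Finset (V × V × β)) (hA : ∀ e ∈ A, e.1 ∈ R ∧ e.2.1 ∈ R) :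
    ∃ F ⊆ A, F.sup pairSetoid = A.sup pairSetoid ∧
      ∀ t, (F.filter fun e => t < w e).card + classCount (A.sup pairSetoid) R ≤
        classCount ((A.filter fun e => w e ≤ t).sup pairSetoid) R := by
  induction A using Finset.induction_on_max_value w with
  | empty => exact ⟨∅, by simp, rfl, by simp⟩
  | insert e A _ hmax ih =>
    obtain ⟨F, hFA, hsup, hcount⟩ := ih fun e he => hA e (Finset.mem_insert_of_mem he)
    have heR := hA e (Finset.mem_insert_self _ _)
    have hlow : ∀ t, t < w e → (insert e A).filter (fun e => w e ≤ t) =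
        A.filter fun e => w e ≤ t := by
      intro t ht
      rw [Finset.filter_insert, if_neg (not_le.2 ht)]
    have hall : ∀ t, w e ≤ t → (insert e A).filter (fun e => w e ≤ t) = insert e A := by
      intro t ht
      refine Finset.filter_true_of_mem fun f hf => ?_
      rcases Finset.mem_insert.1 hf with rfl | hf
      · exact ht
      · exact (hmax f hf).trans ht
    have hnone : ∀ t, w e ≤ t → ∀ F' ⊆ insert e A, F'.filter (fun e => t < w e) = ∅ := by
      intro t ht F' hF'
      refine Finset.filter_false_of_mem fun f hf => ?_
      rcases Finset.mem_insert.1 (hF' hf) with rfl | hf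
      · exact not_lt.2 ht
      · exact not_lt.2 ((hmax f hf).trans ht)
    by_cases hrel : (A.sup pairSetoid) e.1 e.2.1
    · have hsup' : (insert e A).sup pairSetoid = A.sup pairSetoid := by
        rw [Finset.sup_insert]
        exact sup_eq_right.2 (pairSetoid_le_iff.2 hrel)
      refine ⟨F, hFA.trans (Finset.subset_insert _ _), hsup.trans hsup'.symm, fun t => ?_⟩
      rcases lt_or_ge t (w e) with ht | ht
      · rw [hlow t ht, hsup']
        exact hcount t
      · rw [hall t ht, hnone t ht F (hFA.trans (Finset.subset_insert _ _))]
        simp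
    · refine ⟨insert e F, Finset.insert_subset_insert _ hFA, ?_, fun t => ?_⟩
      · rw [Finset.sup_insert, Finset.sup_insert, hsup]
      rcases lt_or_ge t (w e) with ht | ht
      · have hmerge := classCount_add_le (s := A.sup pairSetoid)
          (s' := (insert e A).sup pairSetoid) (Finset.sup_mono (Finset.subset_insert _ _))
          (K := R) (K' := {e.1, e.2.1})
          (by
            intro v hv
            rcases Finset.mem_insert.1 hv with rfl | hv
            · exact heR.1
            · rw [Finset.mem_singleton.1 hv]
              exact heR.2) (by simp)
          (by
            have h : ((insert e A).sup pairSetoid) e.1 e.2.1 :=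
              pairSetoid_le_iff.1 (Finset.le_sup (Finset.mem_insert_self _ _))
            intro a ha b hb
            simp only [Finset.mem_insert, Finset.mem_singleton] at ha hb
            rcases ha with rfl | rfl <;> rcases hb with rfl | rfl
            · exact Setoid.refl' _ _
            · exact h
            · exact Setoid.symm' _ h
            · exact Setoid.refl' _ _)
        rw [classCount_pair hrel] at hmerge
        rw [hlow t ht, Finset.filter_insert, if_pos ht]
        have h1 := Finset.card_insert_le e (F.filter fun e => t < w e)
        have h2 := hcount t
        omega
      · rw [hall t ht, hnone t ht _ (Finset.insert_subset_insert _ hFA)]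
        simp

/-! ### Steiner trees -/

theorem cost_union_le {c : Sym2 V → ℝ} (hc : ∀ e, 0 ≤ c e) (F F' : Finset (Sym2 V)) :
    cost c (F ∪ F') ≤ cost c F + cost c F' := by
  unfold cost
  rw [← Finset.sum_union_inter]
  have := Finset.sum_nonneg (s := F ∩ F') fun e _ => hc e
  linarith

theorem cost_mono {c : Sym2 V → ℝ} (hc : ∀ e, 0 ≤ c e) {F F' : Finset (Sym2 V)} (h : F ⊆ F') :
    cost c F ≤ cost c F' :=
  Finset.sum_le_sum_of_subset_of_nonneg h fun e _ _ => hc e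

theorem cost_nonneg {c : Sym2 V → ℝ} (hc : ∀ e, 0 ≤ c e) (F : Finset (Sym2 V)) :
    0 ≤ cost c F :=
  Finset.sum_nonneg fun e _ => hc e

theorem cost_biUnion_le {ι : Type*} {c : Sym2 V → ℝ} (hc : ∀ e, 0 ≤ c e)
    (I : Finset ι) (P : ι → Finset (Sym2 V)) :
    cost c (I.biUnion P) ≤ ∑ i ∈ I, cost c (P i) := by
  classical
  induction I using Finset.induction_on with
  | empty => simp [cost]
  | insert i I hi ih =>
    rw [Finset.biUnion_insert, Finset.sum_insert hi]
    exact (cost_union_le hc _ _).trans (by linarith)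

theorem reachable_fromEdgeSet_mono {F F' : Finset (Sym2 V)} (h : F ⊆ F') {u v : V}
    (huv : (SimpleGraph.fromEdgeSet (↑F : Set (Sym2 V))).Reachable u v) :
    (SimpleGraph.fromEdgeSet (↑F' : Set (Sym2 V))).Reachable u v :=
  huv.mono (SimpleGraph.fromEdgeSet_mono (by exact_mod_cast h))

theorem reachable_erase_of_walk {F : Finset (Sym2 V)} {u v : V} {e : Sym2 V}
    (p : (SimpleGraph.fromEdgeSet (↑F : Set (Sym2 V))).Walk u v) (he : e ∉ p.edges) :
    (SimpleGraph.fromEdgeSet (↑(F.erase e) : Set (Sym2 V))).Reachable u v := by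
  refine ⟨p.transfer _ fun e' he' => ?_⟩
  have h := p.edges_subset_edgeSet he'
  rw [SimpleGraph.edgeSet_fromEdgeSet] at h ⊢
  refine ⟨?_, h.2⟩
  rw [Finset.mem_coe, Finset.mem_erase]
  exact ⟨fun h' => he (h' ▸ he'), h.1⟩

/-- Every edge set connecting the terminals contains a Steiner tree. -/
theorem exists_isSteinerTree_subset {E : Finset (Sym2 V)} {R : Finset V} {H : Finset (Sym2 V)}
    (hHE : H ⊆ E)
    (hH : ∀ u ∈ R, ∀ v ∈ R, (SimpleGraph.fromEdgeSet (↑H : Set (Sym2 V))).Reachable u v) :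
    ∃ F ⊆ H, IsSteinerTree E R F := by
  classical
  obtain ⟨F, hF, hmin⟩ := Finset.exists_min_image (H.powerset.filter fun F : Finset (Sym2 V) => ∀ u ∈ R, ∀ v ∈ R,
    (SimpleGraph.fromEdgeSet (↑F : Set (Sym2 V))).Reachable u v) Finset.card
    ⟨H, by simpa using hH⟩
  rw [Finset.mem_filter, Finset.mem_powerset] at hF
  obtain ⟨hFH, hconn⟩ := hF
  have hess : ∀ e ∈ F, ¬ ∀ u ∈ R, ∀ v ∈ R,
      (SimpleGraph.fromEdgeSet (↑(F.erase e) : Set (Sym2 V))).Reachable u v := by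
    intro e he h
    have := hmin (F.erase e) (by
      rw [Finset.mem_filter, Finset.mem_powerset]
      exact ⟨(Finset.erase_subset _ _).trans hFH, h⟩)
    exact absurd this (not_le.2 (Finset.card_erase_lt_of_mem he))
  refine ⟨F, hFH, hFH.trans hHE, ?_, hconn, ?_⟩
  · rw [SimpleGraph.isAcyclic_iff_forall_isBridge]
    intro e he
    by_contra hb
    have heF : e ∈ F := by
      rw [SimpleGraph.edgeSet_fromEdgeSet] at he
      exact he.1
    refine hess e heF fun u hu v hv => ?_
    obtain ⟨p⟩ := hconn u hu v hv
    have hstep : ∀ a b, (SimpleGraph.fromEdgeSet (↑F : Set (Sym2 V))).Adj a b →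
        (SimpleGraph.fromEdgeSet (↑(F.erase e) : Set (Sym2 V))).Reachable a b := by
      intro a b hab
      rw [SimpleGraph.fromEdgeSet_adj] at hab
      by_cases hae : s(a, b) = e
      · subst hae
        rw [SimpleGraph.isBridge_iff_forall_walk_mem_edges, not_forall] at hb
        obtain ⟨q, hq⟩ := hb
        exact reachable_erase_of_walk q hq
      · refine SimpleGraph.Adj.reachable ?_
        rw [SimpleGraph.fromEdgeSet_adj, Finset.mem_coe, Finset.mem_erase]
        exact ⟨⟨hae, hab.1⟩, hab.2⟩
    clear hu hv
    induction p with
    | nil => exact SimpleGraph.Reachable.refl _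
    | cons h _ ih => exact (hstep _ _ h).trans ih
  · intro v hv
    obtain ⟨e, he⟩ := Finset.card_pos.1 (Nat.pos_of_ne_zero hv)
    rw [Finset.mem_filter] at he
    by_contra hno
    refine hess e he.1 fun a ha b hb => ?_
    obtain ⟨p⟩ := hconn a ha b hb
    refine reachable_erase_of_walk p fun hep => hno ⟨a, ha, ?_⟩
    have hvp : v ∈ p.support := by
      obtain ⟨w, rfl⟩ := Sym2.mem_iff_exists.1 he.2
      exact p.fst_mem_support_of_mem_edges hep
    exact ⟨(p.takeUntil v hvp).reverse⟩

/-! ### The contracted terminal graph -/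

open Classical in
/-- Terminal pairs `(u, w, P)` such that the edges of `P ⊆ E` connect `u` and `w` once the
edges of `Q` are available. -/
noncomputable def connectors (E : Finset (Sym2 V)) (R : Finset V) (Q : Finset (Sym2 V)) :
    Finset (V × V × Finset (Sym2 V)) :=
  Finset.univ.filter fun e => e.1 ∈ R ∧ e.2.1 ∈ R ∧ e.2.2 ⊆ E ∧
    (SimpleGraph.fromEdgeSet (↑(e.2.2 ∪ Q) : Set (Sym2 V))).Reachable e.1 e.2.1

open Classical in
/-- The partition of the terminals induced by the connectors of cost at most `t`. -/
noncomputable def levelSetoid (E : Finset (Sym2 V)) (R : Finset V) (c : Sym2 V → ℝ)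
    (Q : Finset (Sym2 V)) (t : ℝ) : Setoid V :=
  ((connectors E R Q).filter fun e => cost c e.2.2 ≤ t).sup pairSetoid

/-- The cost of a minimum terminal spanning tree after buying `Q`, as an integral over
thresholds. -/
noncomputable def residualCost (E : Finset (Sym2 V)) (R : Finset V) (c : Sym2 V → ℝ)
    (Q : Finset (Sym2 V)) : ℝ :=
  ∫ t in (0 : ℝ)..(2 * cost c E), ((classCount (levelSetoid E R c Q t) R : ℝ) - 1)

/-- The saving in `residualCost` obtained by contracting `K`. -/
noncomputable def drop (E : Finset (Sym2 V)) (R : Finset V) (c : Sym2 V → ℝ)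
    (Q : Finset (Sym2 V)) (K : Finset V) : ℝ :=
  ∫ t in (0 : ℝ)..(2 * cost c E), ((classCount (levelSetoid E R c Q t) K : ℝ) - 1)

theorem levelSetoid_mono {E : Finset (Sym2 V)} {R : Finset V} {c : Sym2 V → ℝ}
    {Q Q' : Finset (Sym2 V)} (hQ : Q ⊆ Q') {t t' : ℝ} (ht : t ≤ t') :
    levelSetoid E R c Q t ≤ levelSetoid E R c Q' t' := by
  refine Finset.sup_mono fun e he => ?_
  simp only [connectors, Finset.mem_filter, Finset.mem_univ, true_and] at he ⊢
  obtain ⟨⟨h1, h2, h3, h4⟩, h5⟩ := he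
  exact ⟨⟨h1, h2, h3, reachable_fromEdgeSet_mono (Finset.union_subset_union_right hQ) h4⟩,
    h5.trans ht⟩

theorem levelSetoid_of_reachable {E : Finset (Sym2 V)} {R : Finset V} {c : Sym2 V → ℝ}
    {Q P : Finset (Sym2 V)} {t : ℝ} {u w : V} (hu : u ∈ R) (hw : w ∈ R) (hP : P ⊆ E)
    (huw : (SimpleGraph.fromEdgeSet (↑(P ∪ Q) : Set (Sym2 V))).Reachable u w)
    (ht : cost c P ≤ t) : levelSetoid E R c Q t u w := by
  have h : (u, w, P) ∈ (connectors E R Q).filter fun e => cost c e.2.2 ≤ t := by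
    simp only [connectors, Finset.mem_filter, Finset.mem_univ, true_and]
    exact ⟨⟨hu, hw, hP, huw⟩, ht⟩
  exact pairSetoid_le_iff.1 (Finset.le_sup (f := pairSetoid) h)

theorem intervalIntegrable_classCount (E : Finset (Sym2 V)) (R : Finset V) (c : Sym2 V → ℝ)
    (Q : Finset (Sym2 V)) (K : Finset V) (m : ℝ) :
    IntervalIntegrable (fun t => (classCount (levelSetoid E R c Q t) K : ℝ) - 1)
      MeasureTheory.volume 0 m := by
  refine Antitone.intervalIntegrable fun t t' h => ?_
  exact sub_le_sub_right (Nat.cast_le.2 (classCount_anti (levelSetoid_mono subset_rfl h) K)) 1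

/-- Buying `Q` and then a minimum terminal spanning tree yields a Steiner tree. -/
theorem opt_le_cost_add_residualCost {E : Finset (Sym2 V)} {R : Finset V} {c : Sym2 V → ℝ}
    (hc : ∀ e, 0 ≤ c e) (hR : R.Nonempty) {opt : ℝ}
    (hopt : IsMinCostOf (IsSteinerTree E R) c opt) {Q : Finset (Sym2 V)} (hQ : Q ⊆ E) :
    opt ≤ cost c Q + residualCost E R c Q := by
  classical
  obtain ⟨⟨T, hT, -⟩, hmin⟩ := hopt
  obtain ⟨F, hFA, hsup, hcount⟩ := exists_greedy_subset R (fun e => cost c e.2.2)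
    (connectors E R Q) (by
      intro e he
      simp only [connectors, Finset.mem_filter] at he
      exact ⟨he.2.1, he.2.2.1⟩)
  have hFmem : ∀ e ∈ F, e.1 ∈ R ∧ e.2.1 ∈ R ∧ e.2.2 ⊆ E ∧
      (SimpleGraph.fromEdgeSet (↑(e.2.2 ∪ Q) : Set (Sym2 V))).Reachable e.1 e.2.1 := by
    intro e he
    simpa [connectors] using hFA he
  set H := Q ∪ F.biUnion fun e => e.2.2 with hHdef
  have hall : ∀ u ∈ R, ∀ v ∈ R, (connectors E R Q).sup pairSetoid u v := by
    intro u hu v hv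
    have h : (u, v, E) ∈ connectors E R Q := by
      simp only [connectors, Finset.mem_filter, Finset.mem_univ, true_and]
      exact ⟨hu, hv, subset_rfl, reachable_fromEdgeSet_mono
        (hT.1.trans Finset.subset_union_left) (hT.2.2.1 u hu v hv)⟩
    exact pairSetoid_le_iff.1 (Finset.le_sup (f := pairSetoid) h)
  have hle : F.sup pairSetoid ≤ (SimpleGraph.fromEdgeSet (↑H : Set (Sym2 V))).reachableSetoid := by
    refine Finset.sup_le fun e he => pairSetoid_le_iff.2 ?_
    refine reachable_fromEdgeSet_mono ?_ (hFmem e he).2.2.2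
    exact Finset.union_subset ((Finset.subset_biUnion_of_mem (fun e => e.2.2) he).trans
      Finset.subset_union_right) Finset.subset_union_left
  obtain ⟨F', hF'H, hF'⟩ := exists_isSteinerTree_subset (E := E) (R := R) (H := H)
    (Finset.union_subset hQ (Finset.biUnion_subset.2 fun e he => (hFmem e he).2.2.1))
    (fun u hu v hv => hle (hsup ▸ hall u hu v hv))
  have h1 : opt ≤ cost c Q + ∑ e ∈ F, cost c e.2.2 := by
    refine (hmin F' hF').trans ((cost_mono hc hF'H).trans ((cost_union_le hc _ _).trans ?_))
    exact add_le_add_right (cost_biUnion_le hc _ _) _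
  have hE := cost_nonneg hc E
  have h2 : ∑ e ∈ F, cost c e.2.2 ≤ residualCost E R c Q := by
    rw [← integral_card_lt (m := 2 * cost c E) F (fun e => cost c e.2.2)
      (fun e _ => cost_nonneg hc _)
      (fun e he => by linarith [cost_mono hc (hFmem e he).2.2.1])]
    refine intervalIntegral.integral_mono_on (by linarith) (intervalIntegrable_card_lt _ _ _)
      (intervalIntegrable_classCount _ _ _ _ _ _) fun t _ => ?_
    have h := hcount t
    have hone : 0 < classCount ((connectors E R Q).sup pairSetoid) R := classCount_pos hR
    have h' : (F.filter fun e => t < cost c e.2.2).card + 1 ≤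
        classCount (levelSetoid E R c Q t) R := by
      unfold levelSetoid
      convert (Nat.add_le_add_left hone _).trans h using 2
    have : ((F.filter fun e => t < cost c e.2.2).card : ℝ) + 1 ≤
        classCount (levelSetoid E R c Q t) R := by exact_mod_cast h'
    linarith
  linarith

/-- The weighted form of the partition inequalities. -/
theorem residualCost_le_sum_drop {E : Finset (Sym2 V)} {R : Finset V} {c : Sym2 V → ℝ}
    (hc : ∀ e, 0 ≤ c e) {x : Finset V → ℝ} (hx : LPFeasible E R x) (Q : Finset (Sym2 V)) :
    residualCost E R c Q ≤ ∑ K : Finset V, x K * drop E R c Q K := by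
  unfold drop
  simp_rw [← intervalIntegral.integral_const_mul]
  rw [← intervalIntegral.integral_finsetSum
    fun K _ => (intervalIntegrable_classCount E R c Q K _).const_mul (x K)]
  refine intervalIntegral.integral_mono_on (by linarith [cost_nonneg hc E])
    (intervalIntegrable_classCount _ _ _ _ _ _) ?_ fun t _ => hx.partition_le _
  have h := IntervalIntegrable.sum Finset.univ
    fun K _ => (intervalIntegrable_classCount E R c Q K (2 * cost c E)).const_mul (x K)
  rwa [Finset.sum_fn] at h

/-! ### Full components of quasi-bipartite instances -/

/-- In a quasi-bipartite instance every full component is a single edge or a star. -/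
theorem IsFullComponent.eq_edge_or_star {E : Finset (Sym2 V)} {R K : Finset V}
    {F : Finset (Sym2 V)} (hqb : ∀ e ∈ E, ∃ v, v ∈ e ∧ v ∈ R) (hF : IsFullComponent E R K F) :
    (∃ u w, u ≠ w ∧ F = {s(u, w)} ∧ K = {u, w}) ∨
      ∃ v, v ∉ K ∧ F = K.image fun r => s(v, r) := by
  obtain ⟨hFE, hKR, hK2, -, hconn, hdeg, hint⟩ := hF
  have hne : ∀ {e : Sym2 V} {z : V}, e ∈ F → z ∈ e → degIn F z ≠ 0 := fun he hz =>
    Finset.card_ne_zero_of_mem (Finset.mem_filter.2 ⟨he, hz⟩)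
  have huniq : ∀ {e e' : Sym2 V} {z : V}, z ∈ K → e ∈ F → z ∈ e → e' ∈ F → z ∈ e' →
      e = e' := fun hz he hze he' hze' =>
    Finset.card_le_one.1 ((hdeg _).2 hz).le _ (Finset.mem_filter.2 ⟨he, hze⟩) _
      (Finset.mem_filter.2 ⟨he', hze'⟩)
  have hleaf : ∀ {e : Sym2 V} {z : V}, e ∈ F → z ∈ e → z ∈ R → z ∈ K := by
    intro e z he hz hzR
    have h1 := hne he hz
    have h2 : ¬ 2 ≤ degIn F z := fun h => hint z h hzR
    exact (hdeg z).1 (by omega)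
  have hedge : ∀ {z : V}, z ∈ K → ∃ e ∈ F, z ∈ e := by
    intro z hz
    obtain ⟨e, he⟩ := Finset.card_pos.1 (by rw [← degIn, (hdeg z).2 hz]; norm_num :
      0 < (F.filter fun e => z ∈ e).card)
    exact ⟨e, Finset.mem_filter.1 he⟩
  obtain ⟨a, ha, b, hb, hab⟩ := Finset.one_lt_card.1 hK2
  obtain ⟨v, hav, havF⟩ : ∃ v, a ≠ v ∧ s(a, v) ∈ F := by
    obtain ⟨p⟩ := hconn a b (by rw [(hdeg a).2 ha]; norm_num) (by rw [(hdeg b).2 hb]; norm_num)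
    cases p with
    | nil => exact absurd rfl hab
    | cons h _ =>
      rw [SimpleGraph.fromEdgeSet_adj] at h
      exact ⟨_, h.2, h.1⟩
  have hcenter : ∀ r, s(v, r) ∈ F → r ∈ K := by
    intro r hr
    by_cases hvR : v ∈ R
    · have h := huniq (hleaf hr (Sym2.mem_mk_left _ _) hvR) hr (Sym2.mem_mk_left _ _) havF
        (Sym2.mem_mk_right _ _)
      rw [Sym2.eq_swap, Sym2.congr_left] at h
      exact h ▸ ha
    · obtain ⟨z, hz, hzR⟩ := hqb _ (hFE hr)
      rcases Sym2.mem_iff.1 hz with rfl | rfl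
      · exact absurd hzR hvR
      · exact hleaf hr (Sym2.mem_mk_right _ _) hzR
  have hstar : ∀ e ∈ F, v ∈ e := by
    intro e he
    obtain ⟨z, hz⟩ : ∃ z, z ∈ e := ⟨_, Sym2.out_fst_mem e⟩
    have hreach := hconn v z (hne havF (Sym2.mem_mk_right _ _)) (hne he hz)
    rw [SimpleGraph.reachable_iff_reflTransGen] at hreach
    have hmem : z = v ∨ (z ∈ K ∧ s(v, z) ∈ F) := by
      clear hz
      induction hreach with
      | refl => exact Or.inl rfl
      | @tail y z _ hyz ih =>
        rw [SimpleGraph.fromEdgeSet_adj] at hyz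
        have hfrom : y = v → z = v ∨ (z ∈ K ∧ s(v, z) ∈ F) := by
          rintro rfl
          exact Or.inr ⟨hcenter _ hyz.1, hyz.1⟩
        rcases ih with h | ⟨hyK, hyF⟩
        · exact hfrom h
        · have h := huniq hyK hyz.1 (Sym2.mem_mk_left _ _) hyF (Sym2.mem_mk_right _ _)
          rw [Sym2.eq_swap, Sym2.congr_left] at h
          exact Or.inl h
    rcases hmem with rfl | ⟨hzK, hzF⟩
    · exact hz
    · rw [huniq hzK he hz hzF (Sym2.mem_mk_right _ _)]
      exact Sym2.mem_mk_left _ _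
  by_cases hvK : v ∈ K
  · have hone : ∀ e ∈ F, e = s(a, v) := fun e he =>
      huniq hvK he (hstar e he) havF (Sym2.mem_mk_right _ _)
    refine Or.inl ⟨a, v, hav, Finset.eq_singleton_iff_unique_mem.2 ⟨havF, hone⟩, ?_⟩
    ext r
    rw [Finset.mem_insert, Finset.mem_singleton]
    constructor
    · intro hr
      obtain ⟨e, he, hre⟩ := hedge hr
      rw [hone e he] at hre
      exact Sym2.mem_iff.1 hre
    · rintro (rfl | rfl)
      · exact ha
      · exact hvK
  · refine Or.inr ⟨v, hvK, ?_⟩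
    ext e
    rw [Finset.mem_image]
    constructor
    · intro he
      obtain ⟨r, rfl⟩ := Sym2.mem_iff_exists.1 (hstar e he)
      exact ⟨r, hcenter r he, rfl⟩
    · rintro ⟨r, hr, rfl⟩
      obtain ⟨e, he, hre⟩ := hedge hr
      have hrv : r ≠ v := fun h => hvK (h ▸ hr)
      have hev := (Sym2.mem_and_mem_iff hrv).1 ⟨hre, hstar e he⟩
      rwa [Sym2.eq_swap, ← hev]

/-- Pointwise bounds on class counts integrate to bounds on residual costs and drops. -/
theorem residual_drop_bounds {ι : Type*} {E : Finset (Sym2 V)} {R K : Finset V}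
    {c : Sym2 V → ℝ} (hc : ∀ e, 0 ≤ c e) (I : Finset ι) (b : ι → ℝ) {L : Finset (Sym2 V)}
    (hb0 : ∀ i ∈ I, 0 ≤ b i) (hb : ∀ i ∈ I, b i ≤ cost c E)
    (hstep : ∀ Q t, classCount (levelSetoid E R c (Q ∪ L) t) R +
      classCount (levelSetoid E R c Q t) K ≤
        classCount (levelSetoid E R c Q t) R + 1 + (I.filter fun i => t < b i).card)
    (hinit : ∀ t, 0 ≤ t → classCount (levelSetoid E R c ∅ t) K ≤
      1 + (I.filter fun i => t < 2 * b i).card) :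
    (∀ Q, residualCost E R c (Q ∪ L) + drop E R c Q K ≤ residualCost E R c Q + ∑ i ∈ I, b i) ∧
      drop E R c ∅ K ≤ 2 * ∑ i ∈ I, b i := by
  have hE := cost_nonneg hc E
  constructor
  · intro Q
    rw [← integral_card_lt (m := 2 * cost c E) I b hb0 (fun i hi => by linarith [hb i hi])]
    unfold residualCost drop
    have hint := intervalIntegrable_classCount E R c
    rw [← intervalIntegral.integral_add (hint _ _ _) (hint _ _ _),
      ← intervalIntegral.integral_add (hint _ _ _) (intervalIntegrable_card_lt _ _ _)]
    refine intervalIntegral.integral_mono_on (by linarith) ((hint _ _ _).add (hint _ _ _))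
      ((hint _ _ _).add (intervalIntegrable_card_lt _ _ _)) fun t _ => ?_
    have h : ((classCount (levelSetoid E R c (Q ∪ L) t) R +
      classCount (levelSetoid E R c Q t) K : ℕ) : ℝ) ≤
        (classCount (levelSetoid E R c Q t) R + 1 + (I.filter fun i => t < b i).card : ℕ) :=
      Nat.cast_le.2 (hstep Q t)
    push_cast at h
    linarith
  · rw [Finset.mul_sum, ← integral_card_lt (m := 2 * cost c E) I (fun i => 2 * b i)
      (fun i hi => by linarith [hb0 i hi]) (fun i hi => by linarith [hb i hi])]
    refine intervalIntegral.integral_mono_on (by linarith)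
      (intervalIntegrable_classCount _ _ _ _ _ _) (intervalIntegrable_card_lt _ _ _)
      fun t ht => ?_
    have h : ((classCount (levelSetoid E R c ∅ t) K : ℕ) : ℝ) ≤
        (1 + (I.filter fun i => t < 2 * b i).card : ℕ) := Nat.cast_le.2 (hinit t ht.1)
    push_cast at h
    linarith

/-- A full component has a subset `L` (its loss) such that buying `L` lowers the residual cost by
the drop of the component minus the cost of its remaining edges. -/
theorem IsFullComponent.exists_loss {E : Finset (Sym2 V)} {R K : Finset V} {c : Sym2 V → ℝ}
    {F : Finset (Sym2 V)} (hc : ∀ e, 0 ≤ c e) (hqb : ∀ e ∈ E, ∃ v, v ∈ e ∧ v ∈ R)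
    (hF : IsFullComponent E R K F) :
    ∃ L ⊆ F, (∀ Q, residualCost E R c (Q ∪ L) + drop E R c Q K ≤
        residualCost E R c Q + (cost c F - cost c L)) ∧
      drop E R c ∅ K ≤ 2 * (cost c F - cost c L) := by
  have hFE := hF.1
  have hKR := hF.2.1
  have hK2 := hF.2.2.1
  have hcE : ∀ e ∈ E, c e ≤ cost c E := fun e he =>
    Finset.single_le_sum (f := c) (fun e _ => hc e) he
  have hrel : ∀ {s : Setoid V} {r : V} {K' : Finset V}, (∀ a ∈ K', s r a) →
      ∀ a ∈ K', ∀ b ∈ K', s a b := fun h a ha b hb =>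
    Setoid.trans' _ (Setoid.symm' _ (h a ha)) (h b hb)
  rcases hF.eq_edge_or_star hqb with ⟨u, w, huw, rfl, rfl⟩ | ⟨v, hvK, rfl⟩
  · have huE : s(u, w) ∈ E := hFE (Finset.mem_singleton_self _)
    have hcount : ∀ Q t, classCount (levelSetoid E R c Q t) {u, w} ≤
        1 + (({w} : Finset V).filter fun _ => t < c s(u, w)).card := by
      intro Q t
      rcases lt_or_ge t (c s(u, w)) with ht | ht
      · have := classCount_le_card (levelSetoid E R c Q t) {u, w}
        rw [Finset.card_pair huw] at this
        simpa [Finset.filter_singleton, ht] using this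
      · refine (classCount_le_one (hrel (r := u) fun a ha => ?_)).trans (Nat.le_add_right _ _)
        rcases Finset.mem_insert.1 ha with rfl | ha
        · exact Setoid.refl' _ _
        · rw [Finset.mem_singleton.1 ha]
          refine levelSetoid_of_reachable (P := {s(u, w)}) (hKR (by simp)) (hKR (by simp))
            (by simpa using huE) (SimpleGraph.Adj.reachable ?_) (by simpa [cost] using ht)
          simp [SimpleGraph.fromEdgeSet_adj, huw]
    have h := residual_drop_bounds (R := R) (K := {u, w}) (L := ∅) hc {w}
      (fun _ => c s(u, w)) (fun _ _ => hc _) (fun _ _ => hcE _ huE)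
      (fun Q t => by
        rw [Finset.union_empty]
        have := hcount Q t
        omega)
      (fun t _ => by
        refine (hcount ∅ t).trans (Nat.add_le_add_left (Finset.card_le_card ?_) 1)
        refine Finset.monotone_filter_right _ fun i _ hi => ?_
        linarith [hc s(u, w)])
    refine ⟨∅, Finset.empty_subset _, ?_⟩
    simpa [cost] using h
  · have hKne : K.Nonempty := Finset.card_pos.1 (by omega)
    obtain ⟨r₀, hr₀, hmin⟩ := Finset.exists_min_image K (fun r => c s(v, r)) hKne
    have hvE : ∀ r ∈ K, s(v, r) ∈ E := fun r hr => hFE (Finset.mem_image_of_mem _ hr)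
    have hadj : ∀ {P : Finset (Sym2 V)} {r : V}, r ∈ K → s(v, r) ∈ P →
        (SimpleGraph.fromEdgeSet (↑P : Set (Sym2 V))).Adj v r := by
      intro P r hr hP
      rw [SimpleGraph.fromEdgeSet_adj]
      exact ⟨hP, fun h => hvK (h ▸ hr)⟩
    have hcover : ∀ (b : V → ℝ) (t : ℝ), K ⊆ insert r₀ (K.filter fun r => b r ≤ t) ∪
        (K.erase r₀).filter fun r => t < b r := by
      intro b t r hr
      simp only [Finset.mem_union, Finset.mem_insert, Finset.mem_filter, Finset.mem_erase]
      by_cases h : r = r₀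
      · exact Or.inl (Or.inl h)
      · rcases lt_or_ge t (b r) with ht | ht
        · exact Or.inr ⟨⟨h, hr⟩, ht⟩
        · exact Or.inl (Or.inr ⟨hr, ht⟩)
    have hsplit : ∀ (s : Setoid V) (b : V → ℝ) (t : ℝ), classCount s K ≤
        classCount s (insert r₀ (K.filter fun r => b r ≤ t)) +
          ((K.erase r₀).filter fun r => t < b r).card := fun s b t =>
      (classCount_mono_set s (hcover b t)).trans (classCount_union_le _ _ _)
    have h := residual_drop_bounds (R := R) (K := K) (L := {s(v, r₀)}) hc (K.erase r₀)
      (fun r => c s(v, r)) (fun _ _ => hc _)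
      (fun r hr => hcE _ (hvE r (Finset.mem_of_mem_erase hr)))
      (fun Q t => by
        have h1 := hsplit (levelSetoid E R c Q t) (fun r => c s(v, r)) t
        have h2 := classCount_add_le (s := levelSetoid E R c Q t)
          (s' := levelSetoid E R c (Q ∪ {s(v, r₀)}) t)
          (levelSetoid_mono Finset.subset_union_left le_rfl) (K := R)
          (K' := insert r₀ (K.filter fun r => c s(v, r) ≤ t))
          (Finset.insert_subset (hKR hr₀) ((Finset.filter_subset _ _).trans hKR)) (by simp)
          (hrel (r := r₀) fun r hr => by
            rcases Finset.mem_insert.1 hr with rfl | hr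
            · exact Setoid.refl' _ _
            · rw [Finset.mem_filter] at hr
              exact levelSetoid_of_reachable (P := {s(v, r)}) (hKR hr₀) (hKR hr.1)
                (by simpa using hvE r hr.1)
                ((hadj hr₀ (by simp)).symm.reachable.trans (hadj hr.1 (by simp)).reachable)
                (by simpa [cost] using hr.2))
        omega)
      (fun t ht => by
        refine (hsplit _ (fun r => 2 * c s(v, r)) t).trans (Nat.add_le_add_right ?_ _)
        refine classCount_le_one (hrel (r := r₀) fun r hr => ?_)
        rcases Finset.mem_insert.1 hr with rfl | hr
        · exact Setoid.refl' _ _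
        · rw [Finset.mem_filter] at hr
          refine levelSetoid_of_reachable (P := {s(v, r₀)} ∪ {s(v, r)}) (hKR hr₀) (hKR hr.1)
            (Finset.union_subset (by simpa using hvE r₀ hr₀) (by simpa using hvE r hr.1))
            ((hadj hr₀ (by simp)).symm.reachable.trans (hadj hr.1 (by simp)).reachable) ?_
          have h1 := cost_union_le hc {s(v, r₀)} {s(v, r)}
          simp only [cost, Finset.sum_singleton] at h1 ⊢
          linarith [hmin r hr.1, hr.2])
    have hcost : cost c (K.image fun r => s(v, r)) - cost c {s(v, r₀)} =
        ∑ r ∈ K.erase r₀, c s(v, r) := by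
      unfold cost
      rw [Finset.sum_image fun a _ b _ h => Sym2.congr_right.1 h, Finset.sum_singleton,
        ← Finset.add_sum_erase K (fun r => c s(v, r)) hr₀, add_sub_cancel_left]
    refine ⟨{s(v, r₀)}, by simpa using ⟨r₀, hr₀, Or.inl rfl⟩, ?_⟩
    rw [hcost]
    exact h

/-! ### The loss-contracting potential argument -/

/-- Greedy steps whose progress is proportional to the excess over `lp` lead to a logarithmic
bound. -/
theorem le_add_log_of_greedy {β : Type*} [DecidableEq β] {E : Finset β} {f y : Finset β → ℝ}
    {opt lp L : ℝ} (hL : 0 < L) (hopt : ∀ Q ⊆ E, opt ≤ f Q + y Q)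
    (hstep : ∀ Q ⊆ E, lp < y Q → ∃ Q' ⊆ E, Q ⊆ Q' ∧ ∃ l, 0 ≤ l ∧ f Q' ≤ f Q + l ∧
      y Q' < y Q ∧ y Q' ≤ y Q - l * (1 + (y Q - lp) / L))
    {Q : Finset β} (hQ : Q ⊆ E) (hy : lp < y Q) :
    opt ≤ f Q + lp + L * Real.log ((y Q - lp + L) / L) := by
  induction hn : (E \ Q).card using Nat.strong_induction_on generalizing Q with
  | _ n ih =>
  obtain ⟨Q', hQ', hQQ', l, hl, hf, hlt, hle⟩ := hstep Q hQ hy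
  have hz : 0 < (y Q - lp + L) / L := div_pos (by linarith) hL
  have hle' : y Q' - lp + L ≤ (y Q - lp + L) * (1 - l / L) := by
    refine le_trans (b := y Q - l * (1 + (y Q - lp) / L) - lp + L) (by linarith) (le_of_eq ?_)
    field_simp
    ring
  rcases lt_or_ge lp (y Q') with hy' | hy'
  · have hcard : (E \ Q').card < n := by
      rw [← hn]
      refine Finset.card_lt_card ⟨Finset.sdiff_subset_sdiff subset_rfl hQQ', fun h => ?_⟩
      have : Q' = Q := by
        refine subset_antisymm (fun e he => ?_) hQQ'
        by_contra heQ
        exact (Finset.mem_sdiff.1 (h (Finset.mem_sdiff.2 ⟨hQ' he, heQ⟩))).2 he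
      rw [this] at hlt
      exact lt_irrefl _ hlt
    refine (ih _ hcard hQ' hy' rfl).trans ?_
    have hz' : 0 < (y Q' - lp + L) / L := div_pos (by linarith) hL
    have hlog := Real.log_le_sub_one_of_pos (div_pos hz' hz)
    rw [Real.log_div hz'.ne' hz.ne'] at hlog
    have hratio : (y Q' - lp + L) / L / ((y Q - lp + L) / L) ≤ 1 - l / L := by
      rw [div_div_div_cancel_right₀ hL.ne', div_le_iff₀ (by linarith)]
      linarith
    have hmul : L * (Real.log ((y Q' - lp + L) / L) - Real.log ((y Q - lp + L) / L)) ≤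
        L * (-(l / L)) := mul_le_mul_of_nonneg_left (by linarith) hL.le
    have hcancel : L * (-(l / L)) = -l := by field_simp
    linarith
  · refine (hopt Q' hQ').trans ?_
    have hlog := Real.one_sub_inv_le_log_of_pos hz
    have hmul := mul_le_mul_of_nonneg_left hlog hL.le
    have hpos : 0 < y Q - lp + L := by linarith
    have hkey : l + (y Q' - lp) ≤ L * (1 - ((y Q - lp + L) / L)⁻¹) := by
      have h1 : l * (y Q - lp + L) ≤ L * (y Q - y Q') := by
        have h2 : L * (y Q' - lp + L) ≤ L * ((y Q - lp + L) * (1 - l / L)) :=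
          mul_le_mul_of_nonneg_left hle' hL.le
        have h3 : L * ((y Q - lp + L) * (1 - l / L)) =
            L * (y Q - lp + L) - l * (y Q - lp + L) := by field_simp
        nlinarith
      have h4 : L * (1 - ((y Q - lp + L) / L)⁻¹) =
          L * (y Q - lp) / (y Q - lp + L) := by field_simp; ring
      rw [h4, le_div_iff₀ hpos]
      nlinarith [mul_nonneg (sub_nonneg.2 hy') (sub_nonneg.2 hy.le)]
    linarith

/-- The bound `opt ≤ lp + L log (1 + (mst - lp) / L)` for every `L` exceeding the fractional
loss. -/
theorem opt_le_add_log {E : Finset (Sym2 V)} {R : Finset V} {c : Sym2 V → ℝ}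
    (hc : ∀ e, 0 ≤ c e) (hR : R.Nonempty) {opt : ℝ}
    (hopt : IsMinCostOf (IsSteinerTree E R) c opt) {x : Finset V → ℝ} (hx : LPFeasible E R x)
    {F loss : Finset V → Finset (Sym2 V)}
    (hF : ∀ K, x K ≠ 0 → F K ⊆ E ∧ loss K ⊆ F K)
    (hdrop : ∀ K, x K ≠ 0 → ∀ Q, residualCost E R c (Q ∪ loss K) + drop E R c Q K ≤
      residualCost E R c Q + (cost c (F K) - cost c (loss K)))
    {L : ℝ} (hL : ∑ K : Finset V, x K * cost c (loss K) < L) {Q : Finset (Sym2 V)} (hQ : Q ⊆ E)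
    (hy : ∑ K : Finset V, x K * cost c (F K) < residualCost E R c Q) :
    opt ≤ cost c Q + ∑ K : Finset V, x K * cost c (F K) +
      L * Real.log ((residualCost E R c Q - ∑ K : Finset V, x K * cost c (F K) + L) / L) := by
  classical
  set lp := ∑ K : Finset V, x K * cost c (F K) with hlp
  have hL0 : 0 < L := lt_of_le_of_lt
    (Finset.sum_nonneg fun K _ => mul_nonneg (hx.1 K) (cost_nonneg hc _)) hL
  refine le_add_log_of_greedy (E := E) (y := residualCost E R c) hL0
    (fun Q hQ => opt_le_cost_add_residualCost hc hR hopt hQ) ?_ hQ hy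
  intro Q hQ hy
  set ρ := (residualCost E R c Q - lp) / L with hρ
  have hρ0 : 0 < ρ := div_pos (by linarith) hL0
  have hsum : 0 < ∑ K : Finset V,
      x K * (drop E R c Q K - cost c (F K) - cost c (loss K) * ρ) := by
    have h1 := residualCost_le_sum_drop hc hx Q
    have h2 : ∑ K : Finset V, x K * (drop E R c Q K - cost c (F K) - cost c (loss K) * ρ) =
        ∑ K : Finset V, x K * drop E R c Q K - lp -
          (∑ K : Finset V, x K * cost c (loss K)) * ρ := by
      rw [hlp, Finset.sum_mul, ← Finset.sum_sub_distrib, ← Finset.sum_sub_distrib]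
      exact Finset.sum_congr rfl fun K _ => by ring
    have h3 : L * ρ = residualCost E R c Q - lp := by
      rw [hρ]
      field_simp
    have h4 := mul_lt_mul_of_pos_right hL hρ0
    linarith
  obtain ⟨K, -, hK⟩ := Finset.exists_lt_of_sum_lt (f := fun _ => (0 : ℝ)) (by simpa using hsum)
  have hxK : x K ≠ 0 := by
    intro h
    simp [h] at hK
  have hgain : 0 < drop E R c Q K - cost c (F K) - cost c (loss K) * ρ :=
    pos_of_mul_pos_right hK (hx.1 K)
  have hl := cost_nonneg hc (loss K)
  have hlρ := mul_nonneg hl hρ0.le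
  have hd := hdrop K hxK Q
  refine ⟨Q ∪ loss K, Finset.union_subset hQ ((hF K hxK).2.trans (hF K hxK).1),
    Finset.subset_union_left, cost c (loss K), hl, cost_union_le hc _ _, by linarith, ?_⟩
  rw [mul_add, mul_one]
  linarith

/-!
STATEMENT 10: in a quasi-bipartite instance (no edge of `G` joins two Steiner vertices),
the integrality gap of the hypergraphic LP (S) is at most `α`, the unique real solution
of `α = 1 + exp(−α)`: the minimum cost `opt` of a Steiner tree satisfies `opt ≤ α·lp*`.
-/

theorem quasi_bipartite_integrality_gap
    (E : Finset (Sym2 V)) (R : Finset V) (c : Sym2 V → ℝ)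
    (hc : ∀ e, 0 ≤ c e)
    (htri : ∀ u v w : V, c s(u, w) ≤ c s(u, v) + c s(v, w))
    (hqb : ∀ e ∈ E, ∃ v, v ∈ e ∧ v ∈ R)
    (α : ℝ) (hα : α = 1 + Real.exp (-α))
    (CK : Finset V → ℝ)
    (hCK : ∀ K : Finset V, (∃ F, IsFullComponent E R K F) →
      IsMinCostOf (IsFullComponent E R K) c (CK K))
    (lpstar : ℝ) (hlp : IsLPOpt E R CK lpstar)
    (opt : ℝ) (hopt : IsMinCostOf (IsSteinerTree E R) c opt) :
    opt ≤ α * lpstar := by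
  classical
  obtain ⟨⟨x, hx, rfl⟩, -⟩ := hlp
  have hR : R.Nonempty := by
    rw [Finset.nonempty_iff_ne_empty]
    rintro rfl
    have h := hx.2.2.2
    rw [Finset.card_empty, Nat.cast_zero, zero_sub] at h
    have h0 : 0 ≤ ∑ K : Finset V, x K * ((K.card : ℝ) - 1) := by
      refine Finset.sum_nonneg fun K _ => ?_
      by_cases hK : x K = 0
      · simp [hK]
      · have : (2 : ℝ) ≤ K.card := by exact_mod_cast (hx.2.1 K hK).2.1
        exact mul_nonneg (hx.1 K) (by linarith)
    linarith
  have hcomp : ∀ K, ∃ F loss : Finset (Sym2 V), x K ≠ 0 → cost c F = CK K ∧ F ⊆ E ∧ loss ⊆ F ∧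
      (∀ Q, residualCost E R c (Q ∪ loss) + drop E R c Q K ≤
        residualCost E R c Q + (cost c F - cost c loss)) ∧
      drop E R c ∅ K ≤ 2 * (cost c F - cost c loss) := by
    intro K
    by_cases hK : x K = 0
    · exact ⟨∅, ∅, fun h => absurd hK h⟩
    · obtain ⟨F, hF, hcost⟩ := (hCK K (hx.2.1 K hK).2.2).1
      obtain ⟨loss, hloss, h⟩ := hF.exists_loss hc hqb
      exact ⟨F, loss, fun _ => ⟨hcost, hF.1, hloss, h⟩⟩
  choose F loss hFl using hcomp
  have hlp : lpValue CK x = ∑ K : Finset V, x K * cost c (F K) := by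
    refine Finset.sum_congr rfl fun K _ => ?_
    by_cases hK : x K = 0
    · simp [hK]
    · rw [(hFl K hK).1, mul_comm]
  rw [hlp]
  set lp := ∑ K : Finset V, x K * cost c (F K) with hlpdef
  set ℓ := ∑ K : Finset V, x K * cost c (loss K) with hℓ
  have hlp0 : 0 ≤ lp := Finset.sum_nonneg fun K _ => mul_nonneg (hx.1 K) (cost_nonneg hc _)
  have hℓ0 : 0 ≤ ℓ := Finset.sum_nonneg fun K _ => mul_nonneg (hx.1 K) (cost_nonneg hc _)
  have hexp := Real.exp_pos (-α)
  have hmst : residualCost E R c ∅ ≤ 2 * (lp - ℓ) := by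
    refine (residualCost_le_sum_drop hc hx ∅).trans ?_
    rw [hlpdef, hℓ, ← Finset.sum_sub_distrib, Finset.mul_sum]
    refine Finset.sum_le_sum fun K _ => ?_
    by_cases hK : x K = 0
    · simp [hK]
    · have := mul_le_mul_of_nonneg_left (hFl K hK).2.2.2.2 (hx.1 K)
      linarith
  rcases le_or_gt (residualCost E R c ∅) lp with hy | hy
  · have h := opt_le_cost_add_residualCost hc hR hopt (Finset.empty_subset E)
    have hα1 : lp ≤ α * lp := le_mul_of_one_le_left hlp0 (by linarith)
    simp only [cost, Finset.sum_empty] at h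
    linarith
  refine le_of_forall_pos_le_add fun ε hε => ?_
  set δ := ε / (Real.exp (-α) + α) with hδdef
  have hden : 0 < Real.exp (-α) + α := by linarith
  have hδ : 0 < δ := div_pos hε hden
  have hδε : δ * (Real.exp (-α) + α) = ε := div_mul_cancel₀ _ hden.ne'
  have hL : 0 < ℓ + δ := by linarith
  have h := opt_le_add_log hc hR hopt hx (F := F) (loss := loss)
    (fun K hK => ⟨(hFl K hK).2.1, (hFl K hK).2.2.1⟩) (fun K hK => (hFl K hK).2.2.2.1)
    (L := ℓ + δ) (by linarith) (Finset.empty_subset E) hy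
  set u := (residualCost E R c ∅ - lp + (ℓ + δ)) / (ℓ + δ) with hu
  have hu0 : 0 < u := div_pos (by linarith) hL
  have hlog : Real.log u ≤ u * Real.exp (-α) + α - 1 := by
    have := Real.log_le_sub_one_of_pos (mul_pos hu0 hexp)
    rw [Real.log_mul hu0.ne' hexp.ne', Real.log_exp] at this
    linarith
  have hmul := mul_le_mul_of_nonneg_left hlog hL.le
  have hLu : (ℓ + δ) * u = residualCost E R c ∅ - lp + (ℓ + δ) := mul_div_cancel₀ _ hL.ne'
  have hbound : (ℓ + δ) * u * Real.exp (-α) ≤ (lp - ℓ + δ) * Real.exp (-α) :=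
    mul_le_mul_of_nonneg_right (by linarith) hexp.le
  have hαexp : Real.exp (-α) = α - 1 := by linarith
  rw [hαexp] at hmul hbound hδε
  have hcost0 : cost c ∅ = 0 := Finset.sum_empty
  rw [hcost0] at h
  nlinarith
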